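/- arXiv:1707.04768 — 3 statements merged into one kernel-verified Lean document; each statement's English description precedes it below -/
import Mathlib

section
/- Let 0 < E_D < E₀, let K_1, …, K_m ∈ ℝ^{n×n} be symmetric positive semidefinite, and let f ∈ ℝ^n. Then the inner cost functional Φ(δ, u) = −2 fᵀu + Σ_{e=1}^m h(δ_e) uᵀK_e u, where h(δ) = ((1−δ)/E₀ + δ/E_D)⁻¹, is jointly convex in (δ, u) on [0,1]^m × ℝ^n. -/
open Matrix

/-- The harmonic material interpolation between moduli `E₀` and `E_D`. -/
noncomputable def hInterp (E₀ E_D δ : ℝ) : ℝ := ((1 - δ) / E₀ + δ / E_D)⁻¹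

theorem hInterp_denom_pos {E₀ E_D δ : ℝ} (hED : 0 < E_D) (hE₀ : 0 < E₀)
    (hδ : δ ∈ Set.Icc (0 : ℝ) 1) : 0 < (1 - δ) / E₀ + δ / E_D := by
  obtain ⟨h0, h1⟩ := hδ
  rcases h0.eq_or_lt with rfl | h0
  · simpa using hE₀
  · have := div_nonneg (sub_nonneg.2 h1) hE₀.le
    have := div_pos h0 hED
    linarith

/-- The perspective `(s, u) ↦ s⁻¹ uᵀAu` of a positive semidefinite quadratic form is jointly convex
on `(0, ∞) × ℝⁿ`. -/
theorem Matrix.PosSemidef.convexOn_inv_mul_quadratic {ι : Type*} [Fintype ι]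
    {A : Matrix ι ι ℝ} (hA : A.PosSemidef) :
    ConvexOn ℝ {p : ℝ × (ι → ℝ) | 0 < p.1} (fun p => p.1⁻¹ * (p.2 ⬝ᵥ A *ᵥ p.2)) := by
  refine ⟨(convex_Ioi (0 : ℝ)).linear_preimage (LinearMap.fst ℝ ℝ (ι → ℝ)), ?_⟩
  rintro ⟨s, u⟩ hs ⟨t, v⟩ ht a b ha hb hab
  simp only [Set.mem_ofPred_eq] at hs ht
  have hst : 0 < a * s + b * t := (convex_Ioi (0 : ℝ)) hs ht ha hb hab
  have hq : 0 ≤ (t • u - s • v) ⬝ᵥ A *ᵥ (t • u - s • v) := by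
    simpa using hA.dotProduct_mulVec_nonneg (t • u - s • v)
  simp only [Prod.smul_mk, Prod.mk_add_mk, smul_eq_mul, mulVec_add, mulVec_sub, mulVec_smul,
    dotProduct_add, add_dotProduct, dotProduct_sub, sub_dotProduct, dotProduct_smul,
    smul_dotProduct] at hq ⊢
  rw [inv_mul_le_iff₀ hst, ← sub_nonneg]
  have hnonneg : 0 ≤ a * b / (s * t) *
      (t * (t * (u ⬝ᵥ A *ᵥ u)) - s * (t * (v ⬝ᵥ A *ᵥ u))
        - (t * (s * (u ⬝ᵥ A *ᵥ v)) - s * (s * (v ⬝ᵥ A *ᵥ v)))) := by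
    refine mul_nonneg (by positivity) ?_
    linarith
  refine hnonneg.trans_eq ?_
  field_simp
  ring

theorem convexOn_hInterp_mul_quadratic {E₀ E_D : ℝ} (hED : 0 < E_D) (hE₀ : 0 < E₀)
    {ι : Type*} [Fintype ι] {A : Matrix ι ι ℝ} (hA : A.PosSemidef) :
    ConvexOn ℝ {p : ℝ × (ι → ℝ) | p.1 ∈ Set.Icc (0 : ℝ) 1}
      (fun p => hInterp E₀ E_D p.1 * (p.2 ⬝ᵥ A *ᵥ p.2)) := by
  refine ⟨(convex_Icc (0 : ℝ) 1).linear_preimage (LinearMap.fst ℝ ℝ (ι → ℝ)), ?_⟩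
  rintro ⟨x, u⟩ hx ⟨y, v⟩ hy a b ha hb hab
  have h := hA.convexOn_inv_mul_quadratic.2
    (x := ((1 - x) / E₀ + x / E_D, u)) (hInterp_denom_pos hED hE₀ hx)
    (y := ((1 - y) / E₀ + y / E_D, v)) (hInterp_denom_pos hED hE₀ hy) ha hb hab
  have haffine : (1 - (a * x + b * y)) / E₀ + (a * x + b * y) / E_D
      = a * ((1 - x) / E₀ + x / E_D) + b * ((1 - y) / E₀ + y / E_D) := by
    obtain rfl : b = 1 - a := by linarith
    ring
  simp only [hInterp, Prod.smul_mk, Prod.mk_add_mk, smul_eq_mul, haffine] at h ⊢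
  exact h

/-- Joint convexity in `(δ, u)` of the inner cost functional
`Φ(δ,u) = −2 fᵀu + Σ_e h(δ_e) uᵀK_e u` on `[0,1]^m × ℝⁿ`. -/
theorem stmt_5 (m n : ℕ) (E₀ E_D : ℝ) (hED : 0 < E_D) (hE : E_D < E₀)
    (K : Fin m → Matrix (Fin n) (Fin n) ℝ) (hK : ∀ e, (K e).PosSemidef)
    (f : Fin n → ℝ) :
    ConvexOn ℝ {p : (Fin m → ℝ) × (Fin n → ℝ) | ∀ e, p.1 e ∈ Set.Icc (0 : ℝ) 1}
      (fun p => -2 * (f ⬝ᵥ p.2) + ∑ e, hInterp E₀ E_D (p.1 e) * (p.2 ⬝ᵥ K e *ᵥ p.2)) := by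
  have hconv : Convex ℝ
      {p : (Fin m → ℝ) × (Fin n → ℝ) | ∀ e, p.1 e ∈ Set.Icc (0 : ℝ) 1} := by
    intro p hp q hq a b ha hb hab e
    exact convex_Icc (0 : ℝ) 1 (hp e) (hq e) ha hb hab
  refine ⟨hconv, ?_⟩
  intro p hp q hq a b ha hb hab
  have hsum := Finset.sum_le_sum fun e (_ : e ∈ Finset.univ) =>
    (convexOn_hInterp_mul_quadratic hED (hED.trans hE) (hK e)).2
      (x := (p.1 e, p.2)) (hp e) (y := (q.1 e, q.2)) (hq e) ha hb hab
  simp only [Prod.smul_mk, Prod.mk_add_mk, Prod.fst_add, Prod.snd_add, Prod.smul_fst,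
    Prod.smul_snd, Pi.add_apply, Pi.smul_apply, smul_eq_mul, Finset.sum_add_distrib,
    ← Finset.mul_sum, dotProduct_add f, dotProduct_smul _ f] at hsum ⊢
  linarith
end

section
/- Let 0 < E_D < E₀, let K_1, …, K_m ∈ ℝ^{n×n} be symmetric positive semidefinite with K_1 + … + K_m positive definite, let f ∈ ℝ^n and μ > 0. Then the barrier-augmented inner cost functional Φ_μ(δ, u) = −2 fᵀu + Σ_{e=1}^m h(δ_e) uᵀK_e u − μ Σ_{e=1}^m (log δ_e + log(1−δ_e)), with h(δ) = ((1−δ)/E₀ + δ/E_D)⁻¹, is strictly convex on (0,1)^m × ℝ^n. -/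
open Matrix

/-- The gap in Jensen's inequality for the quadratic-over-linear function `(s, u) ↦ s⁻¹ uᵀAu`. -/
theorem quadratic_over_linear_gap {n : ℕ} {A : Matrix (Fin n) (Fin n) ℝ} (hA : A.IsSymm)
    {s t a b : ℝ} (hs : 0 < s) (ht : 0 < t) (ha : 0 < a) (hb : 0 < b) (hab : a + b = 1)
    (u v : Fin n → ℝ) :
    a * (s⁻¹ * (u ⬝ᵥ A *ᵥ u)) + b * (t⁻¹ * (v ⬝ᵥ A *ᵥ v))
      - (a * s + b * t)⁻¹ * ((a • u + b • v) ⬝ᵥ A *ᵥ (a • u + b • v))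
      = a * b * (s * t * (a * s + b * t))⁻¹ * ((t • u - s • v) ⬝ᵥ A *ᵥ (t • u - s • v)) := by
  have hsymm : v ⬝ᵥ A *ᵥ u = u ⬝ᵥ A *ᵥ v := by
    rw [dotProduct_mulVec, ← mulVec_transpose, hA.eq, dotProduct_comm]
  have hst : a * s + b * t ≠ 0 := by positivity
  simp only [mulVec_add, mulVec_sub, mulVec_smul, dotProduct_add, dotProduct_sub, add_dotProduct,
    sub_dotProduct, smul_dotProduct, dotProduct_smul, smul_eq_mul, hsymm]
  obtain rfl : b = 1 - a := by linarith
  field_simp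
  ring

theorem hInterp_pos {E₀ E_D δ : ℝ} (hE₀ : 0 < E₀) (hED : 0 < E_D) (hδ : δ ∈ Set.Ioo (0 : ℝ) 1) :
    0 < hInterp E₀ E_D δ := by
  have h₀ := hδ.1
  have h₁ : 0 < 1 - δ := sub_pos.2 hδ.2
  unfold hInterp
  positivity

theorem hInterp_inv_combo (E₀ E_D x y : ℝ) {a b : ℝ} (hab : a + b = 1) :
    (hInterp E₀ E_D (a * x + b * y))⁻¹
      = a * (hInterp E₀ E_D x)⁻¹ + b * (hInterp E₀ E_D y)⁻¹ := by
  obtain rfl : b = 1 - a := by linarith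
  simp only [hInterp, inv_inv]
  ring

/-- The gap in Jensen's inequality for the energy `(δ, u) ↦ h(δ) uᵀAu` of one element. -/
theorem element_energy_gap {n : ℕ} {A : Matrix (Fin n) (Fin n) ℝ} (hA : A.IsSymm)
    {E₀ E_D x y a b : ℝ} (hE₀ : 0 < E₀) (hED : 0 < E_D) (hx : x ∈ Set.Ioo (0 : ℝ) 1)
    (hy : y ∈ Set.Ioo (0 : ℝ) 1) (ha : 0 < a) (hb : 0 < b) (hab : a + b = 1)
    (u v : Fin n → ℝ) :
    ∃ c > 0, a * (hInterp E₀ E_D x * (u ⬝ᵥ A *ᵥ u)) + b * (hInterp E₀ E_D y * (v ⬝ᵥ A *ᵥ v))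
      - hInterp E₀ E_D (a * x + b * y) * ((a • u + b • v) ⬝ᵥ A *ᵥ (a • u + b • v))
      = c * (((hInterp E₀ E_D y)⁻¹ • u - (hInterp E₀ E_D x)⁻¹ • v) ⬝ᵥ
        A *ᵥ ((hInterp E₀ E_D y)⁻¹ • u - (hInterp E₀ E_D x)⁻¹ • v)) := by
  have hx' := inv_pos.2 (hInterp_pos hE₀ hED hx)
  have hy' := inv_pos.2 (hInterp_pos hE₀ hED hy)
  have gap := quadratic_over_linear_gap hA hx' hy' ha hb hab u v
  rw [← hInterp_inv_combo E₀ E_D x y hab] at gap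
  simp only [inv_inv] at gap
  refine ⟨_, ?_, gap⟩
  rw [hInterp_inv_combo E₀ E_D x y hab]
  positivity

theorem Matrix.PosSemidef.isSymm_real {n : ℕ} {A : Matrix (Fin n) (Fin n) ℝ}
    (hA : A.PosSemidef) : A.IsSymm :=
  (conjTranspose_eq_transpose_of_trivial A).symm.trans hA.isHermitian

theorem element_energy_jensen {n : ℕ} {A : Matrix (Fin n) (Fin n) ℝ} (hA : A.PosSemidef)
    {E₀ E_D x y a b : ℝ} (hE₀ : 0 < E₀) (hED : 0 < E_D) (hx : x ∈ Set.Ioo (0 : ℝ) 1)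
    (hy : y ∈ Set.Ioo (0 : ℝ) 1) (ha : 0 < a) (hb : 0 < b) (hab : a + b = 1)
    (u v : Fin n → ℝ) :
    hInterp E₀ E_D (a * x + b * y) * ((a • u + b • v) ⬝ᵥ A *ᵥ (a • u + b • v))
      ≤ a * (hInterp E₀ E_D x * (u ⬝ᵥ A *ᵥ u)) + b * (hInterp E₀ E_D y * (v ⬝ᵥ A *ᵥ v)) := by
  obtain ⟨c, hc, gap⟩ := element_energy_gap hA.isSymm_real hE₀ hED hx hy ha hb hab u v
  rw [← sub_nonneg, gap]
  exact mul_nonneg hc.le (by simpa only [star_trivial] using hA.dotProduct_mulVec_nonneg _)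

theorem element_energy_jensen_strict {n : ℕ} {A : Matrix (Fin n) (Fin n) ℝ} (hA : A.IsSymm)
    {E₀ E_D x a b : ℝ} (hE₀ : 0 < E₀) (hED : 0 < E_D) (hx : x ∈ Set.Ioo (0 : ℝ) 1)
    (ha : 0 < a) (hb : 0 < b) (hab : a + b = 1) {u v : Fin n → ℝ}
    (huv : 0 < (u - v) ⬝ᵥ A *ᵥ (u - v)) :
    hInterp E₀ E_D (a * x + b * x) * ((a • u + b • v) ⬝ᵥ A *ᵥ (a • u + b • v))
      < a * (hInterp E₀ E_D x * (u ⬝ᵥ A *ᵥ u)) + b * (hInterp E₀ E_D x * (v ⬝ᵥ A *ᵥ v)) := by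
  obtain ⟨c, hc, gap⟩ := element_energy_gap hA hE₀ hED hx hx ha hb hab u v
  have hx' := inv_pos.2 (hInterp_pos hE₀ hED hx)
  rw [← sub_pos, gap, ← smul_sub, mulVec_smul, smul_dotProduct, dotProduct_smul, smul_eq_mul,
    smul_eq_mul]
  positivity

theorem strictConcaveOn_log_add_log_one_sub :
    StrictConcaveOn ℝ (Set.Ioo (0 : ℝ) 1) fun x => Real.log x + Real.log (1 - x) := by
  refine (strictConcaveOn_log_Ioi.subset Set.Ioo_subset_Ioi_self (convex_Ioo 0 1)).add_concaveOn
    ⟨convex_Ioo 0 1, fun x hx y hy a b ha hb hab => ?_⟩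
  have h := strictConcaveOn_log_Ioi.concaveOn.2 (sub_pos.2 hx.2) (sub_pos.2 hy.2) ha hb hab
  simp only [smul_eq_mul] at h ⊢
  rwa [show 1 - (a * x + b * y) = a * (1 - x) + b * (1 - y) by linear_combination -hab]

/-- Strict convexity on `(0,1)^m × ℝⁿ` of the barrier-augmented inner cost functional
`Φ_μ(δ,u) = −2 fᵀu + Σ_e h(δ_e) uᵀK_e u − μ Σ_e (log δ_e + log (1−δ_e))`,
assuming the total stiffness `Σ_e K_e` is positive definite. -/
theorem stmt_6 (m n : ℕ) (E₀ E_D : ℝ) (hED : 0 < E_D) (hE : E_D < E₀)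
    (K : Fin m → Matrix (Fin n) (Fin n) ℝ) (hK : ∀ e, (K e).PosSemidef)
    (hKsum : (∑ e, K e).PosDef) (f : Fin n → ℝ) (μ : ℝ) (hμ : 0 < μ) :
    StrictConvexOn ℝ {p : (Fin m → ℝ) × (Fin n → ℝ) | ∀ e, p.1 e ∈ Set.Ioo (0 : ℝ) 1}
      (fun p => -2 * (f ⬝ᵥ p.2) + ∑ e, hInterp E₀ E_D (p.1 e) * (p.2 ⬝ᵥ K e *ᵥ p.2)
        - μ * ∑ e, (Real.log (p.1 e) + Real.log (1 - p.1 e))) := by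
  have hE₀ : 0 < E₀ := hED.trans hE
  refine ⟨?_, ?_⟩
  · intro p hp q hq a b ha hb hab e
    exact convex_Ioo (0 : ℝ) 1 (hp e) (hq e) ha hb hab
  rintro ⟨x, u⟩ hx ⟨y, v⟩ hy hne a b ha hb hab
  simp only [Set.mem_ofPred_eq] at hx hy
  have energy e := element_energy_jensen (hK e) hE₀ hED (hx e) (hy e) ha hb hab u v
  have barrier e := strictConcaveOn_log_add_log_one_sub.concaveOn.2 (hx e) (hy e) ha.le hb.le hab
  have energy_sum := Finset.sum_le_sum fun e (_ : e ∈ Finset.univ) => energy e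
  have barrier_sum := Finset.sum_le_sum fun e (_ : e ∈ Finset.univ) => barrier e
  simp only [smul_eq_mul, Finset.sum_add_distrib, ← Finset.mul_sum] at energy_sum barrier_sum
  simp only [Prod.fst_add, Prod.snd_add, Prod.smul_fst, Prod.smul_snd, Pi.add_apply,
    Pi.smul_apply, smul_eq_mul, dotProduct_add, dotProduct_smul, Finset.sum_add_distrib]
  by_cases hxy : x = y
  · subst hxy
    have huv : u - v ≠ 0 := sub_ne_zero.2 fun h => hne (by rw [h])
    have hpos : 0 < ∑ e, (u - v) ⬝ᵥ K e *ᵥ (u - v) := by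
      simpa [sum_mulVec, dotProduct_sum] using hKsum.dotProduct_mulVec_pos huv
    obtain ⟨e, -, he⟩ := Finset.exists_lt_of_sum_lt (s := Finset.univ) (f := fun _ => (0 : ℝ))
      (by simpa only [Finset.sum_const_zero] using hpos)
    have strict := Finset.sum_lt_sum (fun e (_ : e ∈ Finset.univ) => energy e) ⟨e,
      Finset.mem_univ e, element_energy_jensen_strict (hK e).isSymm_real hE₀ hED (hx e)
        ha hb hab he⟩
    simp only [Finset.sum_add_distrib, ← Finset.mul_sum] at strict
    linarith [mul_le_mul_of_nonneg_left barrier_sum hμ.le]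
  · obtain ⟨e, he⟩ := Function.ne_iff.1 hxy
    have strict := Finset.sum_lt_sum (fun e (_ : e ∈ Finset.univ) => barrier e) ⟨e,
      Finset.mem_univ e, strictConcaveOn_log_add_log_one_sub.2 (hx e) (hy e) he ha hb hab⟩
    simp only [smul_eq_mul, Finset.sum_add_distrib, ← Finset.mul_sum] at strict
    linarith [mul_lt_mul_of_pos_left strict hμ]
end

section
/- Let 0 < E_D < E₀, let K_1, …, K_m ∈ ℝ^{n×n} be symmetric positive semidefinite with K_1 + … + K_m positive definite, and let f ∈ ℝ^n. Define K(δ) = Σ_{e=1}^m h(δ_e) K_e with h(δ) = ((1−δ)/E₀ + δ/E_D)⁻¹. Then K(δ) is symmetric positive definite for every δ ∈ [0,1]^m, and the compliance c(δ) = fᵀK(δ)⁻¹f is a concave function of δ on [0,1]^m. -/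
open Matrix

/-- Weighted sums of positive semidefinite matrices are positive definite as soon as the weights
are bounded below by a positive constant and the unweighted sum is positive definite. -/
theorem posDef_sum_smul_of_le {ι κ : Type*} [Fintype ι] [Fintype κ] {K : ι → Matrix κ κ ℝ}
    (hK : ∀ e, (K e).PosSemidef) (hKsum : (∑ e, K e).PosDef) {c : ℝ} (hc : 0 < c)
    {h : ι → ℝ} (hh : ∀ e, c ≤ h e) : (∑ e, h e • K e).PosDef := by
  have key : ∑ e, h e • K e = c • ∑ e, K e + ∑ e, (h e - c) • K e := by
    rw [Finset.smul_sum, ← Finset.sum_add_distrib]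
    refine Finset.sum_congr rfl fun e _ => ?_
    rw [← add_smul, add_sub_cancel]
  rw [key]
  exact (hKsum.smul hc).add_posSemidef
    (posSemidef_sum _ fun e _ => (hK e).smul (sub_nonneg.2 (hh e)))

/-- Complementary energy principle: the compliance is at most the complementary energy
of any family `v` whose internal forces `K e *ᵥ v e` balance the load `f`. -/
theorem compliance_le_complementary_energy {ι κ : Type*} [Fintype ι] [Fintype κ] [DecidableEq κ]
    {K : ι → Matrix κ κ ℝ} (hK : ∀ e, (K e).PosSemidef) {h : ι → ℝ} (hh : ∀ e, 0 < h e)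
    (hP : (∑ e, h e • K e).PosDef) {f : κ → ℝ} {v : ι → κ → ℝ} (hv : ∑ e, K e *ᵥ v e = f) :
    f ⬝ᵥ (∑ e, h e • K e)⁻¹ *ᵥ f ≤ ∑ e, (h e)⁻¹ * (v e ⬝ᵥ K e *ᵥ v e) := by
  set u := (∑ e, h e • K e)⁻¹ *ᵥ f with hu
  have hPu : (∑ e, h e • K e) *ᵥ u = f := by
    rw [hu, mulVec_mulVec, mul_nonsing_inv _ ((isUnit_iff_isUnit_det _).1 hP.isUnit), one_mulVec]
  have huu : ∑ e, h e * (u ⬝ᵥ K e *ᵥ u) = f ⬝ᵥ u := by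
    rw [dotProduct_comm f u]
    nth_rewrite 1 [← hPu]
    simp [sum_mulVec, dotProduct_sum, smul_mulVec]
  have huv : ∑ e, u ⬝ᵥ K e *ᵥ v e = f ⬝ᵥ u := by
    rw [dotProduct_comm f u, ← hv, dotProduct_sum]
  have hterm : ∀ e, 0 ≤ (h e)⁻¹ * (v e ⬝ᵥ K e *ᵥ v e) - 2 * (u ⬝ᵥ K e *ᵥ v e)
      + h e * (u ⬝ᵥ K e *ᵥ u) := by
    intro e
    have hsymm : v e ⬝ᵥ K e *ᵥ u = u ⬝ᵥ K e *ᵥ v e := by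
      have ht : (K e)ᵀ = K e := by simpa using (hK e).isHermitian.eq
      rw [dotProduct_mulVec, ← mulVec_transpose, ht, dotProduct_comm]
    have hq := mul_nonneg (inv_nonneg.2 (hh e).le)
      ((hK e).dotProduct_mulVec_nonneg (v e - h e • u))
    simp only [star_trivial, mulVec_sub, mulVec_smul, dotProduct_sub, sub_dotProduct,
      dotProduct_smul, smul_dotProduct, smul_eq_mul, hsymm] at hq
    have hne := (hh e).ne'
    refine hq.trans_eq ?_
    field_simp
    ring
  have hsum := Finset.sum_nonneg fun e (_ : e ∈ Finset.univ) => hterm e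
  rw [Finset.sum_add_distrib, Finset.sum_sub_distrib, ← Finset.mul_sum, huu, huv] at hsum
  linarith

theorem le_hInterp {E₀ E_D δ : ℝ} (hED : 0 < E_D) (hE : E_D ≤ E₀) (h0 : 0 ≤ δ) (h1 : δ ≤ 1) :
    E_D ≤ hInterp E₀ E_D δ := by
  have hE0 : 0 < E₀ := hED.trans_le hE
  have h1' : 0 ≤ 1 - δ := sub_nonneg.2 h1
  have hpos : 0 < (1 - δ) / E₀ + δ / E_D := by
    rcases h0.eq_or_lt with rfl | h0
    · simpa using hE0
    · positivity
  rw [hInterp, le_inv_comm₀ hED hpos]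
  calc (1 - δ) / E₀ + δ / E_D ≤ (1 - δ) / E_D + δ / E_D := by gcongr
    _ = E_D⁻¹ := by rw [← add_div, sub_add_cancel, one_div]

theorem inv_hInterp_add {E₀ E_D a b : ℝ} (hab : a + b = 1) (x y : ℝ) :
    (hInterp E₀ E_D (a * x + b * y))⁻¹ =
      a * (hInterp E₀ E_D x)⁻¹ + b * (hInterp E₀ E_D y)⁻¹ := by
  obtain rfl : b = 1 - a := by linarith
  simp only [hInterp, inv_inv]
  ring

/-- With the harmonic material interpolation, the assembled stiffness
`K(δ) = Σ_e h(δ_e) K_e` is positive definite on `[0,1]^m`, and the compliance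
`c(δ) = fᵀK(δ)⁻¹f` is concave on `[0,1]^m`. -/
theorem stmt_9 (m n : ℕ) (E₀ E_D : ℝ) (hED : 0 < E_D) (hE : E_D < E₀)
    (K : Fin m → Matrix (Fin n) (Fin n) ℝ) (hK : ∀ e, (K e).PosSemidef)
    (hKsum : (∑ e, K e).PosDef) (f : Fin n → ℝ) :
    (∀ δ ∈ Set.Icc (0 : Fin m → ℝ) 1,
      (∑ e, hInterp E₀ E_D (δ e) • K e).PosDef) ∧
    ConcaveOn ℝ (Set.Icc (0 : Fin m → ℝ) 1)
      (fun δ => f ⬝ᵥ (∑ e, hInterp E₀ E_D (δ e) • K e)⁻¹ *ᵥ f) := by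
  have hle : ∀ δ ∈ Set.Icc (0 : Fin m → ℝ) 1, ∀ e, E_D ≤ hInterp E₀ E_D (δ e) :=
    fun δ hδ e => le_hInterp hED hE.le (hδ.1 e) (hδ.2 e)
  have hPD : ∀ δ ∈ Set.Icc (0 : Fin m → ℝ) 1, (∑ e, hInterp E₀ E_D (δ e) • K e).PosDef :=
    fun δ hδ => posDef_sum_smul_of_le hK hKsum hED (hle δ hδ)
  refine ⟨hPD, convex_Icc _ _, fun x hx y hy a b ha hb hab => ?_⟩
  have hz := convex_Icc (0 : Fin m → ℝ) 1 hx hy ha hb hab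
  set z := a • x + b • y
  set u := (∑ e, hInterp E₀ E_D (z e) • K e)⁻¹ *ᵥ f with hu
  have hPu : (∑ e, hInterp E₀ E_D (z e) • K e) *ᵥ u = f := by
    rw [hu, mulVec_mulVec,
      mul_nonsing_inv _ ((isUnit_iff_isUnit_det _).1 (hPD z hz).isUnit), one_mulVec]
  have hv : ∑ e, K e *ᵥ (hInterp E₀ E_D (z e) • u) = f := by
    rw [← hPu]
    simp [sum_mulVec, smul_mulVec, mulVec_smul]
  have hbound : ∀ δ ∈ Set.Icc (0 : Fin m → ℝ) 1, _ := fun δ hδ =>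
    compliance_le_complementary_energy hK (fun e => hED.trans_le (hle δ hδ e)) (hPD δ hδ) hv
  have hmin : f ⬝ᵥ u = ∑ e, (hInterp E₀ E_D (z e))⁻¹ *
      ((hInterp E₀ E_D (z e) • u) ⬝ᵥ K e *ᵥ (hInterp E₀ E_D (z e) • u)) := by
    rw [dotProduct_comm]
    nth_rewrite 1 [← hv]
    rw [dotProduct_sum]
    refine Finset.sum_congr rfl fun e _ => ?_
    rw [smul_dotProduct, smul_eq_mul, inv_mul_cancel_left₀ (hED.trans_le (hle z hz e)).ne']
  calc _ ≤ _ := add_le_add (mul_le_mul_of_nonneg_left (hbound x hx) ha)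
        (mul_le_mul_of_nonneg_left (hbound y hy) hb)
    _ = f ⬝ᵥ u := by
      rw [hmin, Finset.mul_sum, Finset.mul_sum, ← Finset.sum_add_distrib]
      refine Finset.sum_congr rfl fun e _ => ?_
      have hs : (hInterp E₀ E_D (z e))⁻¹ = _ := inv_hInterp_add hab (x e) (y e)
      rw [hs]
      ring
end
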